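/- arXiv:2210.08173 — 5 statements merged into one kernel-verified Lean document; each statement's English description precedes it below -/
import Mathlib

section
/- For any profile P1 over A_m with n voters, any integer m' ≥ 1, and any profile P2 ∈ AppLast(P1, m'), the following hold for every alternative a ∈ A_m: (i) the Dodgson score of a in P2 equals the Dodgson score of a in P1; (ii) if a is a Dodgson winner in P1, then a is also a Dodgson winner in P2. -/
open Finset

/-- A ranking over `m` alternatives: `R a` is the position of alternative `a`,
position `0` being the top. -/
abbrev Ranking (m : ℕ) := Fin m ≃ Fin m

/-- `a` is the Condorcet winner of the profile `P` with `n` voters: strictly more than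
half of the voters prefer `a` to any other alternative. -/
def CondorcetWinner {n m : ℕ} (P : Fin n → Ranking m) (a : Fin m) : Prop :=
  ∀ b : Fin m, b ≠ a → 2 * (univ.filter fun i => P i a < P i b).card > n

/-- One exchange of two adjacent alternatives in a single voter's ranking. -/
def AdjStep {n m : ℕ} (P P' : Fin n → Ranking m) : Prop :=
  ∃ (i : Fin n) (j : ℕ) (h : j + 1 < m),
    P' i = (P i).trans (Equiv.swap ⟨j, Nat.lt_of_succ_lt h⟩ ⟨j + 1, h⟩) ∧
      ∀ k : Fin n, k ≠ i → P' k = P k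

/-- The Dodgson score of alternative `a` in profile `P`: the smallest number of
sequential exchanges of adjacent alternatives making `a` the Condorcet winner. -/
noncomputable def dodgsonScore {n m : ℕ} (P : Fin n → Ranking m) (a : Fin m) : ℕ :=
  sInf {k : ℕ | ∃ Q : ℕ → (Fin n → Ranking m), Q 0 = P ∧
    (∀ t < k, AdjStep (Q t) (Q (t + 1))) ∧ CondorcetWinner (Q k) a}

/-- Lifting `a` by `t i` positions in the ranking of each voter `i` makes it beat every other
alternative by a strict majority. -/
def LiftSuffices {n m : ℕ} (P : Fin n → Ranking m) (a : Fin m) (t : Fin n → ℕ) : Prop :=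
  ∀ b : Fin m, b ≠ a → n < 2 * (univ.filter fun i => (P i a : ℕ) ≤ P i b + t i).card

section

variable {n m : ℕ}

theorem liftSuffices_zero_iff (P : Fin n → Ranking m) (a : Fin m) :
    LiftSuffices P a 0 ↔ CondorcetWinner P a := by
  refine forall₂_congr fun b hb => ?_
  have h : ∀ i, ((P i a : ℕ) ≤ P i b + (0 : Fin n → ℕ) i ↔ P i a < P i b) := fun i => by
    have : P i a ≠ P i b := fun h => hb ((P i).injective h).symm
    rw [Ne, Fin.ext_iff] at this
    rw [Fin.lt_def, Pi.zero_apply]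
    omega
  simp only [h, gt_iff_lt]

theorem LiftSuffices.imp {m₁ m₂ : ℕ} {P : Fin n → Ranking m₁} {P' : Fin n → Ranking m₂}
    {a : Fin m₁} {a' : Fin m₂} {t t' : Fin n → ℕ} (h : LiftSuffices P a t)
    (H : ∀ b', b' ≠ a' → ∃ b, b ≠ a ∧
      ∀ i, (P i a : ℕ) ≤ P i b + t i → (P' i a' : ℕ) ≤ P' i b' + t' i) :
    LiftSuffices P' a' t' := by
  intro b' hb'
  obtain ⟨b, hb, himp⟩ := H b' hb'
  have h₁ := h b hb
  have h₂ := card_le_card (monotone_filter_right univ fun i (_ : i ∈ univ) => himp i)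
  omega

theorem LiftSuffices.of_adjStep {P P' : Fin n → Ranking m} (hP : AdjStep P P') {a : Fin m}
    {t : Fin n → ℕ} (h : LiftSuffices P' a t) :
    ∃ t' : Fin n → ℕ, ∑ i, t' i = ∑ i, t i + 1 ∧ LiftSuffices P a t' := by
  obtain ⟨i, j, hj, hi, hne⟩ := hP
  refine ⟨t + Pi.single i 1, by simp [sum_add_distrib], h.imp fun b hb => ⟨b, hb, fun k hk => ?_⟩⟩
  by_cases hki : k = i
  · subst hki
    rw [hi] at hk
    have hab : P k a ≠ P k b := fun h => hb ((P k).injective h).symm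
    simp only [Equiv.trans_apply, Equiv.swap_apply_def, apply_ite Fin.val, Fin.ext_iff, Ne]
      at hk hab
    simp only [Pi.add_apply, Pi.single_eq_same]
    split_ifs at hk <;> omega
  · rw [hne k hki] at hk
    simpa [hki] using hk

theorem exists_liftSuffices_of_path {a : Fin m} (k : ℕ) (Q : ℕ → Fin n → Ranking m)
    (hQ : ∀ t < k, AdjStep (Q t) (Q (t + 1))) (h : CondorcetWinner (Q k) a) :
    ∃ t : Fin n → ℕ, ∑ i, t i = k ∧ LiftSuffices (Q 0) a t := by
  induction k generalizing Q with
  | zero => exact ⟨0, by simp, (liftSuffices_zero_iff _ _).2 h⟩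
  | succ k ih =>
    obtain ⟨t, rfl, ht⟩ := ih (fun s => Q (s + 1)) (fun s hs => hQ (s + 1) (by omega)) h
    exact ht.of_adjStep (hQ 0 (by omega))

theorem LiftSuffices.exists_path {P : Fin n → Ranking m} {a : Fin m} {t : Fin n → ℕ}
    (h : LiftSuffices P a t) :
    ∃ k ≤ ∑ i, t i, ∃ Q : ℕ → Fin n → Ranking m, Q 0 = P ∧
      (∀ s < k, AdjStep (Q s) (Q (s + 1))) ∧ CondorcetWinner (Q k) a := by
  induction hs : ∑ i, t i generalizing P t with
  | zero =>
    obtain rfl : t = 0 := by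
      ext i
      exact (sum_eq_zero_iff.1 hs) i (mem_univ i)
    exact ⟨0, le_rfl, fun _ => P, rfl, by simp, (liftSuffices_zero_iff _ _).1 h⟩
  | succ s ih =>
    obtain ⟨i, hi⟩ : ∃ i, t i ≠ 0 := by
      by_contra! h0
      simp [h0] at hs
    have hsum : ∑ k, Function.update t i (t i - 1) k = s := by
      have h₁ := sum_update_of_mem (mem_univ i) t (t i - 1)
      have h₂ := sum_update_of_mem (mem_univ i) t (t i)
      rw [Function.update_eq_self] at h₂
      omega
    obtain hp | ⟨j, hj⟩ : (P i a : ℕ) = 0 ∨ ∃ j, (P i a : ℕ) = j + 1 := by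
      cases hPa : (P i a : ℕ) <;> simp
    · obtain ⟨k, hk, hQ⟩ := ih (P := P) (t := Function.update t i (t i - 1))
        (h.imp fun b hb => ⟨b, hb, fun k hk => by
          by_cases hki : k = i
          · subst hki; omega
          · simpa [hki] using hk⟩) hsum
      exact ⟨k, by omega, hQ⟩
    · have hjm : j + 1 < m := hj ▸ (P i a).isLt
      let P' := Function.update P i
        ((P i).trans (Equiv.swap ⟨j, Nat.lt_of_succ_lt hjm⟩ ⟨j + 1, hjm⟩))
      obtain ⟨k, hk, Q, hQ0, hQ, hw⟩ := ih (P := P') (t := Function.update t i (t i - 1))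
        (h.imp fun b hb => ⟨b, hb, fun k hk => by
          by_cases hki : k = i
          · subst hki
            have hab : P k a ≠ P k b := fun h => hb ((P k).injective h).symm
            simp only [Ne, Fin.ext_iff] at hab
            simp only [P', Function.update_self, Equiv.trans_apply, Equiv.swap_apply_def,
              apply_ite Fin.val, Fin.ext_iff]
            split_ifs <;> omega
          · simpa [P', hki] using hk⟩) hsum
      refine ⟨k + 1, by omega, fun | 0 => P | r + 1 => Q r, rfl, fun r hr => ?_, hw⟩
      cases r with
      | zero =>
        refine ⟨i, j, hjm, ?_, fun l hl => ?_⟩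
        · simp [hQ0, P']
        · simp [hQ0, P', hl]
      | succ r => exact hQ r (by omega)

theorem LiftSuffices.dodgsonScore_le {P : Fin n → Ranking m} {a : Fin m} {t : Fin n → ℕ}
    (h : LiftSuffices P a t) : dodgsonScore P a ≤ ∑ i, t i := by
  obtain ⟨k, hk, hQ⟩ := h.exists_path
  exact (Nat.sInf_le hQ).trans hk

theorem exists_liftSuffices_sum_eq_dodgsonScore (hn : 0 < n) (P : Fin n → Ranking m) (a : Fin m) :
    ∃ t : Fin n → ℕ, ∑ i, t i = dodgsonScore P a ∧ LiftSuffices P a t := by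
  have hm : LiftSuffices P a fun _ => m := fun b _ => by
    have (i : Fin n) : (P i a : ℕ) ≤ P i b + m := by omega
    simp [this, hn]
  obtain ⟨k, -, hQ⟩ := hm.exists_path
  obtain ⟨Q, hQ0, hQ, hw⟩ := Nat.sInf_mem (s := {k : ℕ | ∃ Q : ℕ → Fin n → Ranking m,
    Q 0 = P ∧ (∀ s < k, AdjStep (Q s) (Q (s + 1))) ∧ CondorcetWinner (Q k) a}) ⟨k, hQ⟩
  obtain ⟨t, ht, hl⟩ := exists_liftSuffices_of_path _ Q hQ hw
  exact ⟨t, ht, hQ0 ▸ hl⟩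

theorem dodgsonScore_eq_zero_of_no_voters (hm : 2 ≤ m) (P : Fin 0 → Ranking m) (a : Fin m) :
    dodgsonScore P a = 0 := by
  have : Nontrivial (Fin m) := Fin.nontrivial_iff_two_le.2 hm
  obtain ⟨b, hb⟩ := exists_ne a
  refine Nat.sInf_eq_zero.2 (Or.inr (Set.eq_empty_of_forall_notMem ?_))
  rintro k ⟨Q, -, -, hw⟩
  simpa using hw b hb

theorem dodgsonScore_le_of_forall_liftSuffices {m₁ m₂ : ℕ} (hn : 0 < n) {P : Fin n → Ranking m₁}
    {P' : Fin n → Ranking m₂} {a : Fin m₁} {a' : Fin m₂}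
    (h : ∀ t, LiftSuffices P' a' t → LiftSuffices P a t) :
    dodgsonScore P a ≤ dodgsonScore P' a' := by
  obtain ⟨t, ht, hl⟩ := exists_liftSuffices_sum_eq_dodgsonScore hn P' a'
  exact ht ▸ (h t hl).dodgsonScore_le

theorem le_apply_natAdd_of_apply_castAdd {m' : ℕ} {R : Ranking m} {R' : Ranking (m + m')}
    (h : ∀ a, R' (Fin.castAdd m' a) = Fin.castAdd m' (R a)) (d : Fin m') :
    m ≤ R' (Fin.natAdd m d) := by
  by_contra! hlt
  have hd : R' (Fin.castAdd m' (R.symm ⟨_, hlt⟩)) = R' (Fin.natAdd m d) := by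
    rw [h, Equiv.apply_symm_apply]
    rfl
  have hval := congrArg Fin.val (R'.injective hd)
  simp only [Fin.val_castAdd, Fin.val_natAdd] at hval
  omega

end

/-- appending `m'` dummy alternatives at the bottom of every voter's
ranking preserves the Dodgson score of every original alternative, and Dodgson
winners of the original profile remain Dodgson winners. -/
theorem dodgson_appLast (n m m' : ℕ) (_hm : 3 ≤ m) (_hm' : 1 ≤ m')
    (P1 : Fin n → Ranking m) (P2 : Fin n → Ranking (m + m'))
    (hApp : ∀ (i : Fin n) (a : Fin m), P2 i (Fin.castAdd m' a) = Fin.castAdd m' (P1 i a)) :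
    ∀ a : Fin m,
      dodgsonScore P2 (Fin.castAdd m' a) = dodgsonScore P1 a ∧
      ((∀ b : Fin m, dodgsonScore P1 a ≤ dodgsonScore P1 b) →
        ∀ b : Fin (m + m'), dodgsonScore P2 (Fin.castAdd m' a) ≤ dodgsonScore P2 b) := by
  intro a
  rcases Nat.eq_zero_or_pos n with rfl | hn
  · simp only [dodgsonScore_eq_zero_of_no_voters (show 2 ≤ m by omega),
      dodgsonScore_eq_zero_of_no_voters (show 2 ≤ m + m' by omega), le_refl, implies_true, and_self]
  have hdum (i : Fin n) (d : Fin m') : m ≤ P2 i (Fin.natAdd m d) :=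
    le_apply_natAdd_of_apply_castAdd (hApp i) d
  have : Nontrivial (Fin m) := Fin.nontrivial_iff_two_le.2 (by omega)
  have heq (c : Fin m) : dodgsonScore P2 (Fin.castAdd m' c) = dodgsonScore P1 c := by
    apply le_antisymm <;> refine dodgsonScore_le_of_forall_liftSuffices hn fun t ht => ht.imp ?_
    · intro b
      induction b using Fin.addCases with
      | left b =>
        refine fun hb => ⟨b, fun h => hb (h ▸ rfl), fun i hi => ?_⟩
        simpa [hApp] using hi
      | right d =>
        obtain ⟨b, hb⟩ := exists_ne c
        refine fun _ => ⟨b, hb, fun i _ => ?_⟩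
        have := hdum i d
        simp only [hApp, Fin.val_castAdd]
        omega
    · refine fun b hb => ⟨Fin.castAdd m' b, fun h => hb (Fin.castAdd_injective m m' h), ?_⟩
      simp [hApp]
  refine ⟨heq a, fun ha b => ?_⟩
  induction b using Fin.addCases with
  | left b => simpa only [heq] using ha b
  | right d =>
    refine dodgsonScore_le_of_forall_liftSuffices hn fun t ht => ht.imp fun b hb => ?_
    by_cases hbd : b = Fin.natAdd m d
    · refine ⟨Fin.castAdd m' a, fun h => hb (hbd.trans h.symm), fun i _ => ?_⟩
      have := hdum i d
      simp only [hbd, hApp, Fin.val_castAdd]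
      omega
    · refine ⟨b, hbd, fun i hi => ?_⟩
      have := hdum i d
      simp only [hApp, Fin.val_castAdd]
      omega
end

section
/- For any profile P1 over A_m with n voters, any integer m' ≥ 1, and any profile P2 ∈ AppLast(P1, m'), the following hold for every alternative a ∈ A_m: (i) the Young score of a in P2 equals the Young score of a in P1; (ii) if a is a Young winner in P1, then a is also a Young winner in P2. -/
open Finset

/-- The Young score of alternative `a` in profile `P`: the maximum size of a
sub-multiset of the voters in which `a` is the Condorcet winner. -/
noncomputable def youngScore {n m : ℕ} (P : Fin n → Ranking m) (a : Fin m) : ℕ :=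
  sSup {k : ℕ | ∃ S : Finset (Fin n), S.card = k ∧
    ∀ b : Fin m, b ≠ a → 2 * (S.filter fun i => P i a < P i b).card > S.card}

/-- If every voter ranks the original alternatives at the top as in `R`, each dummy
alternative is placed below all original ones. -/
theorem castAdd_lt_natAdd_of_append {m m' : ℕ} {R : Ranking m} {R' : Ranking (m + m')}
    (h : ∀ a : Fin m, R' (Fin.castAdd m' a) = Fin.castAdd m' (R a)) (a : Fin m) (d : Fin m') :
    R' (Fin.castAdd m' a) < R' (Fin.natAdd m d) := by
  have hd : m ≤ (R' (Fin.natAdd m d) : ℕ) := by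
    by_contra! hlt
    have heq : R' (Fin.castAdd m' (R.symm ⟨_, hlt⟩)) = R' (Fin.natAdd m d) := by
      rw [h, Equiv.apply_symm_apply]
      rfl
    have hval := congrArg Fin.val (R'.injective heq)
    simp only [Fin.val_castAdd, Fin.val_natAdd] at hval
    omega
  rw [h, Fin.lt_def, Fin.val_castAdd]
  exact (R a).isLt.trans_le hd

/-- An alternative that every voter ranks below some fixed other alternative has Young
score zero. -/
theorem youngScore_eq_zero_of_dominated {n m : ℕ} {P : Fin n → Ranking m} {a b : Fin m}
    (h : ∀ i, P i b < P i a) (hne : b ≠ a) : youngScore P a = 0 := by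
  refine (congrArg sSup (Set.eq_empty_iff_forall_notMem.2 ?_)).trans csSup_empty
  rintro k ⟨S, -, hS⟩
  have hempty : (S.filter fun i => P i a < P i b) = ∅ :=
    Finset.filter_eq_empty_iff.2 fun i _ => (h i).not_gt
  simpa [hempty] using hS b hne

/-- Appending alternatives at the bottom of every ranking preserves Young scores. -/
theorem youngScore_castAdd_of_append {n m m' : ℕ} (hm : 2 ≤ m)
    {P1 : Fin n → Ranking m} {P2 : Fin n → Ranking (m + m')}
    (h : ∀ (i : Fin n) (a : Fin m), P2 i (Fin.castAdd m' a) = Fin.castAdd m' (P1 i a))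
    (a : Fin m) : youngScore P2 (Fin.castAdd m' a) = youngScore P1 a := by
  have hlt (i : Fin n) (b : Fin m) :
      P2 i (Fin.castAdd m' a) < P2 i (Fin.castAdd m' b) ↔ P1 i a < P1 i b := by
    rw [h, h, Fin.lt_def, Fin.lt_def, Fin.val_castAdd, Fin.val_castAdd]
  unfold youngScore
  congr 1
  ext k
  refine exists_congr fun S => and_congr_right fun _ => ⟨fun hS b hb => ?_, fun hS b => ?_⟩
  · simpa only [hlt] using hS (Fin.castAdd m' b) fun he => hb (Fin.castAdd_injective m m' he)
  · refine Fin.addCases (fun b hb => ?_) (fun d _ => ?_) b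
    · simpa only [hlt] using hS b fun he => hb (congrArg _ he)
    · have : Nontrivial (Fin m) := Fin.nontrivial_iff_two_le.2 hm
      obtain ⟨c, hc⟩ := exists_ne a
      have hcard := hS c hc
      have hle := Finset.card_filter_le S fun i => P1 i a < P1 i c
      rw [Finset.filter_true_of_mem fun i _ => castAdd_lt_natAdd_of_append (h i) a d]
      omega

/-- appending `m'` dummy alternatives at the bottom of every voter's
ranking preserves the Young score of every original alternative, and Young winners
of the original profile remain Young winners. -/
theorem young_appLast (n m m' : ℕ) (_hm : 3 ≤ m) (_hm' : 1 ≤ m')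
    (P1 : Fin n → Ranking m) (P2 : Fin n → Ranking (m + m'))
    (hApp : ∀ (i : Fin n) (a : Fin m), P2 i (Fin.castAdd m' a) = Fin.castAdd m' (P1 i a)) :
    ∀ a : Fin m,
      youngScore P2 (Fin.castAdd m' a) = youngScore P1 a ∧
      ((∀ b : Fin m, youngScore P1 b ≤ youngScore P1 a) →
        ∀ b : Fin (m + m'), youngScore P2 b ≤ youngScore P2 (Fin.castAdd m' a)) := by
  have hscore := youngScore_castAdd_of_append (by omega : 2 ≤ m) hApp
  refine fun a => ⟨hscore a, fun hwin b => ?_⟩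
  refine Fin.addCases (fun b => ?_) (fun d => ?_) b
  · rw [hscore, hscore]
    exact hwin b
  · have hne : Fin.castAdd m' a ≠ Fin.natAdd m d :=
      Fin.ne_of_val_ne (a.isLt.trans_le (Nat.le_add_right m d)).ne
    rw [youngScore_eq_zero_of_dominated
      (fun i => castAdd_lt_natAdd_of_append (hApp i) a d) hne]
    exact Nat.zero_le _
end

section
/- Let P be a weighted profile over A_m with total weight W whose weighted majority graph equals the unweighted directed graph G = (A_m, E), i.e., w_P(a,b) = 1 if (a,b) ∈ E, w_P(a,b) = −1 if (b,a) ∈ E, and w_P(a,b) = 0 if there is no edge between a and b. Then for every ranking R over A_m: KT(P,R) = (W/2)·binom(m,2) − |E|/2 + f(G,R). -/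
open Finset

/-- The Kendall tau distance between two rankings: the number of (unordered) pairs
of alternatives on which they disagree (each disagreeing pair is counted once, in the
orientation preferred by `Q`). -/
def ktRank {m : ℕ} (Q R : Ranking m) : ℕ :=
  (univ.filter fun p : Fin m × Fin m => Q p.1 < Q p.2 ∧ R p.2 < R p.1).card

/-- The KT distance between a weighted profile `w` and a ranking `R`. -/
noncomputable def ktDist {m : ℕ} (w : Ranking m → ℝ) (R : Ranking m) : ℝ :=
  ∑ Q : Ranking m, w Q * (ktRank Q R : ℝ)

/-- The weighted-majority-graph weight of the ordered pair `(a, b)`: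
(total weight of rankings putting `a` above `b`) minus
(total weight of rankings putting `b` above `a`). -/
noncomputable def wmg {m : ℕ} (w : Ranking m → ℝ) (a b : Fin m) : ℝ :=
  (∑ Q ∈ univ.filter (fun Q : Ranking m => Q a < Q b), w Q) -
    ∑ Q ∈ univ.filter (fun Q : Ranking m => Q b < Q a), w Q

/-- `f(G, R)`: the number of backward arcs of the ranking `R` in the directed graph
with arc set `E`, i.e. arcs `(u, v) ∈ E` with `v` ranked above `u` in `R`. -/
def backArcs {m : ℕ} (E : Finset (Fin m × Fin m)) (R : Ranking m) : ℕ :=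
  (E.filter fun p => R p.2 < R p.1).card

/-- The weight of the rankings putting `a` above `b`. -/
noncomputable def supportWeight {m : ℕ} (w : Ranking m → ℝ) (a b : Fin m) : ℝ :=
  ∑ Q : Ranking m, if Q a < Q b then w Q else 0

lemma wmg_eq_sub {m : ℕ} (w : Ranking m → ℝ) (a b : Fin m) :
    wmg w a b = supportWeight w a b - supportWeight w b a := by
  simp only [wmg, supportWeight, sum_filter]

lemma supportWeight_add_swap {m : ℕ} (w : Ranking m → ℝ) {a b : Fin m} (hab : a ≠ b) :
    supportWeight w a b + supportWeight w b a = ∑ Q : Ranking m, w Q := by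
  rw [supportWeight, supportWeight, ← sum_add_distrib]
  refine sum_congr rfl fun Q _ => ?_
  rcases lt_or_gt_of_ne (Q.injective.ne hab) with h | h <;> simp [h, h.not_gt]

lemma supportWeight_eq {m : ℕ} (w : Ranking m → ℝ) {a b : Fin m} (hab : a ≠ b) :
    supportWeight w a b = ((∑ Q : Ranking m, w Q) + wmg w a b) / 2 := by
  linarith [wmg_eq_sub w a b, supportWeight_add_swap w hab]

lemma ktDist_eq_sum_supportWeight {m : ℕ} (w : Ranking m → ℝ) (R : Ranking m) :
    ktDist w R =
      ∑ p ∈ univ.filter (fun p : Fin m × Fin m => R p.2 < R p.1), supportWeight w p.1 p.2 := by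
  simp only [ktDist, supportWeight]
  rw [sum_comm]
  refine sum_congr rfl fun Q _ => ?_
  rw [← sum_filter, filter_filter, sum_const, nsmul_eq_mul, mul_comm, ktRank]
  simp only [and_comm]

/-- Reversing every arc exchanges the arcs that agree with `R` and those that do not. -/
lemma card_filter_swap {m : ℕ} (E : Finset (Fin m × Fin m)) (R : Ranking m) :
    ((univ.filter fun p : Fin m × Fin m => R p.2 < R p.1).filter fun p => p.swap ∈ E).card =
      (E.filter fun p => R p.1 < R p.2).card := by
  refine card_bij' (fun p _ => p.swap) (fun p _ => p.swap) ?_ ?_ ?_ ?_ <;>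
    simp +contextual

lemma card_filter_lt_add_backArcs {m : ℕ} (E : Finset (Fin m × Fin m))
    (hirr : ∀ a : Fin m, (a, a) ∉ E) (R : Ranking m) :
    (E.filter fun p => R p.1 < R p.2).card + backArcs E R = E.card := by
  rw [← card_filter_add_card_filter_not (s := E) (fun p => R p.1 < R p.2), backArcs]
  congr 2
  refine filter_congr fun p hp => ?_
  have hne : p.1 ≠ p.2 := fun h => hirr p.1 (by rwa [show (p.1, p.1) = p from Prod.ext rfl h])
  rw [not_lt]
  exact ⟨le_of_lt, fun h => lt_of_le_of_ne h (R.injective.ne hne.symm)⟩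

lemma card_inverted_pairs {m : ℕ} (R : Ranking m) :
    (univ.filter fun p : Fin m × Fin m => R p.2 < R p.1).card = m.choose 2 := by
  have hb : (univ.filter fun p : Fin m × Fin m => R p.2 < R p.1) =
      (univ : Finset (Fin m)).offDiag.filter fun p => R p.2 < R p.1 := by
    ext p
    simp only [mem_filter, mem_univ, true_and, mem_offDiag, iff_and_self]
    intro h e
    simp [e] at h
  have hs : (univ.filter fun p : Fin m × Fin m => R p.2 < R p.1).card =
      ((univ : Finset (Fin m)).offDiag.filter fun p => R p.1 < R p.2).card := by
    rw [← card_filter_swap, hb, filter_filter]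
    congr 1
    ext p
    simp only [mem_filter, mem_univ, true_and, mem_offDiag, Prod.fst_swap, Prod.snd_swap]
    grind
  have h := card_filter_lt_add_backArcs (univ : Finset (Fin m)).offDiag (by simp) R
  rw [backArcs, ← hs, ← hb, offDiag_card, card_univ, Fintype.card_fin] at h
  rw [Nat.choose_two_right, Nat.mul_sub_one]
  omega

lemma wmg_eq_indicator_sub {m : ℕ} {w : Ranking m → ℝ} {E : Finset (Fin m × Fin m)}
    (hE1 : ∀ a b : Fin m, (a, b) ∈ E → wmg w a b = 1)
    (hE2 : ∀ a b : Fin m, (b, a) ∈ E → wmg w a b = -1)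
    (hE0 : ∀ a b : Fin m, a ≠ b → (a, b) ∉ E → (b, a) ∉ E → wmg w a b = 0)
    {a b : Fin m} (hab : a ≠ b) :
    wmg w a b = (if (a, b) ∈ E then 1 else 0) - (if (b, a) ∈ E then 1 else 0) := by
  by_cases h1 : (a, b) ∈ E <;> by_cases h2 : (b, a) ∈ E
  · linarith [hE1 a b h1, hE2 a b h2]
  · simp [h1, h2, hE1 a b h1]
  · simp [h1, h2, hE2 a b h2]
  · simp [h1, h2, hE0 a b hab h1 h2]

/-- if the weighted majority graph of the weighted profile `w` equals
the unweighted directed graph `G = (A_m, E)`, then for every ranking `R`,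
`KT(P,R) = (W/2)·C(m,2) − |E|/2 + f(G,R)` where `W` is the total weight. -/
theorem kt_of_wmg_eq_graph (m : ℕ) (hm : 3 ≤ m)
    (w : Ranking m → ℝ) (hw : ∀ Q, 0 ≤ w Q)
    (E : Finset (Fin m × Fin m)) (hirr : ∀ a : Fin m, (a, a) ∉ E)
    (hE1 : ∀ a b : Fin m, (a, b) ∈ E → wmg w a b = 1)
    (hE2 : ∀ a b : Fin m, (b, a) ∈ E → wmg w a b = -1)
    (hE0 : ∀ a b : Fin m, a ≠ b → (a, b) ∉ E → (b, a) ∉ E → wmg w a b = 0) :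
    ∀ R : Ranking m,
      ktDist w R = (∑ Q : Ranking m, w Q) / 2 * (m.choose 2 : ℝ)
        - (E.card : ℝ) / 2 + (backArcs E R : ℝ) := by
  intro R
  set D := univ.filter fun p : Fin m × Fin m => R p.2 < R p.1 with hD
  set W := ∑ Q : Ranking m, w Q
  have hsum : ktDist w R = ∑ p ∈ D, (W + (if p ∈ E then (1 : ℝ) else 0)
      - (if p.swap ∈ E then (1 : ℝ) else 0)) / 2 := by
    rw [ktDist_eq_sum_supportWeight]
    refine sum_congr rfl fun p hp => ?_
    have hne : p.1 ≠ p.2 := by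
      intro h
      simp [hD, h] at hp
    rw [supportWeight_eq w hne, wmg_eq_indicator_sub hE1 hE2 hE0 hne]
    rw [← add_sub_assoc]
    rfl
  have hback : (D.filter (· ∈ E)).card = backArcs E R := by
    rw [backArcs, hD, filter_filter]
    congr 1
    ext p
    simp [and_comm]
  have hcard : ((E.filter fun p => R p.1 < R p.2).card : ℝ) + backArcs E R = E.card :=
    mod_cast card_filter_lt_add_backArcs E hirr R
  rw [hsum, ← sum_div, sum_sub_distrib, sum_add_distrib, sum_boole, sum_boole, sum_const,
    nsmul_eq_mul, hback, card_filter_swap, card_inverted_pairs]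
  linarith
end

section
/- Fix m ≥ 3, α ∈ [1 − 1/m, 1], and rankings R_1,…,R_n over A_m, and let ≻_1,…,≻_n be mutually independent random rankings with ≻_i drawn from the α-IC distribution π_{R_i}. Fix distinct alternatives a, b ∈ A_m and let β = (3/4 − 1/(2m))·n/m. Then Pr[ #{i ∈ [n] : a ≺_i b} > n/2 + β ] < exp(−n/(72 m²)). -/
open Finset
open scoped Classical

/-- The `α`-Impartial-Culture distribution centered at the ranking `R`: each ranking
`R'` gets probability `α/m! + (1−α)·1[R' = R]`. -/
noncomputable def alphaIC {m : ℕ} (α : ℝ) (R : Ranking m) : Ranking m → ℝ :=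
  fun R' => α / (Nat.factorial m : ℝ) + (1 - α) * (if R' = R then 1 else 0)

/-- Probability of the event `Ev` when the `n` voters' rankings are drawn mutually
independently, voter `i`'s ranking from the distribution `π i` (product measure). -/
noncomputable def profileProb {n m : ℕ} (π : Fin n → Ranking m → ℝ)
    (Ev : (Fin n → Ranking m) → Prop) : ℝ :=
  ∑ P ∈ univ.filter Ev, ∏ i : Fin n, π i (P i)

/-- **Hoeffding's lemma** for a Bernoulli variable of parameter `q`. -/
lemma bernoulli_mgf_le {q : ℝ} (hq0 : 0 ≤ q) (hq1 : q ≤ 1) (l : ℝ) :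
    1 - q + q * Real.exp l ≤ Real.exp (l * q + l ^ 2 / 8) := by
  let μ : MeasureTheory.Measure ℝ :=
    ENNReal.ofReal (1 - q) • MeasureTheory.Measure.dirac 0 +
      ENNReal.ofReal q • MeasureTheory.Measure.dirac 1
  have hμ : MeasureTheory.IsProbabilityMeasure μ := by
    constructor
    simp [μ, ← ENNReal.ofReal_add (sub_nonneg.2 hq1) hq0]
  have hint (f : ℝ → ℝ) : ∫ x, f x ∂μ = (1 - q) * f 0 + q * f 1 := by
    have hi (c x : ℝ) : MeasureTheory.Integrable f
        (ENNReal.ofReal c • MeasureTheory.Measure.dirac x) :=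
      (MeasureTheory.integrable_dirac (by simp)).smul_measure ENNReal.ofReal_ne_top
    rw [MeasureTheory.integral_add_measure (hi _ _) (hi _ _)]
    simp [hq0, hq1]
  have hae : ∀ᵐ x ∂μ, (id x : ℝ) ∈ Set.Icc (0 : ℝ) 1 := by
    rw [MeasureTheory.ae_add_measure_iff]
    exact ⟨MeasureTheory.Measure.ae_smul_measure (by simp [MeasureTheory.ae_dirac_eq]) _,
      MeasureTheory.Measure.ae_smul_measure (by simp [MeasureTheory.ae_dirac_eq]) _⟩
  have h := (ProbabilityTheory.hasSubgaussianMGF_of_mem_Icc aemeasurable_id hae).mgf_le l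
  rw [ProbabilityTheory.mgf, hint, hint] at h
  norm_num at h
  have h2 := mul_le_mul_of_nonneg_right h (Real.exp_pos (l * q)).le
  rw [← Real.exp_add, add_mul, mul_assoc, mul_assoc, ← Real.exp_add, ← Real.exp_add] at h2
  ring_nf at h2 ⊢
  rw [Real.exp_zero] at h2
  linarith

/-- Exactly half of all rankings prefer `b` to `a`. -/
lemma two_mul_card_ranking_lt {m : ℕ} {a b : Fin m} (hab : a ≠ b) :
    2 * (univ.filter fun r : Ranking m => r b < r a).card = m.factorial := by
  have hswap : (univ.filter fun r : Ranking m => r b < r a).card =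
      (univ.filter fun r : Ranking m => ¬ r b < r a).card := by
    refine card_bij' (fun r _ => (Equiv.swap a b).trans r)
      (fun r _ => (Equiv.swap a b).trans r) ?_ ?_ ?_ ?_
    · intro r hr
      simpa using (mem_filter.1 hr).2.le
    · intro r hr
      have hr := (mem_filter.1 hr).2
      simpa using lt_of_le_of_ne (not_lt.1 hr) (fun h => hab (r.injective h))
    · intro r _
      ext x
      simp
    · intro r _
      ext x
      simp
  have h := card_filter_add_card_filter_not (s := (univ : Finset (Ranking m)))
    (fun r => r b < r a)
  rw [card_univ, Fintype.card_perm, Fintype.card_fin] at h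
  omega

lemma alphaIC_pos {m : ℕ} {α : ℝ} (h0 : 0 < α) (h1 : α ≤ 1) (R r : Ranking m) :
    0 < alphaIC α R r := by
  have : 0 ≤ (1 - α) * (if r = R then (1 : ℝ) else 0) :=
    mul_nonneg (sub_nonneg.2 h1) (by split_ifs <;> norm_num)
  unfold alphaIC
  positivity

lemma sum_alphaIC {m : ℕ} (α : ℝ) (R : Ranking m) : ∑ r, alphaIC α R r = 1 := by
  have hm : (m.factorial : ℝ) ≠ 0 := by positivity
  simp only [alphaIC, sum_add_distrib, sum_const, ← mul_sum, sum_ite_eq', mem_univ, if_true,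
    card_univ, Fintype.card_perm, Fintype.card_fin, nsmul_eq_mul]
  field_simp
  ring

/-- Under `α`-IC, a voter prefers `b` to `a` with probability at most `1 - α / 2`. -/
lemma sum_alphaIC_lt_le {m : ℕ} {α : ℝ} (h1 : α ≤ 1) (R : Ranking m) {a b : Fin m}
    (hab : a ≠ b) :
    ∑ r with r b < r a, alphaIC α R r ≤ 1 - α / 2 := by
  have hm : (m.factorial : ℝ) ≠ 0 := by positivity
  have hc : 2 * ((univ.filter fun r : Ranking m => r b < r a).card : ℝ) = m.factorial := by
    exact_mod_cast two_mul_card_ranking_lt hab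
  have hind : (if R ∈ univ.filter (fun r : Ranking m => r b < r a) then (1 : ℝ) else 0) ≤ 1 := by
    split_ifs <;> norm_num
  simp only [alphaIC, sum_add_distrib, sum_const, ← mul_sum, sum_ite_eq', nsmul_eq_mul]
  have hhalf : ((univ.filter fun r : Ranking m => r b < r a).card : ℝ) * (α / m.factorial)
      = α / 2 := by
    rw [mul_div_assoc', div_eq_div_iff hm two_ne_zero, ← hc]
    ring
  rw [hhalf]
  nlinarith [mul_le_mul_of_nonneg_left hind (sub_nonneg.2 h1)]

/-- Moment generating function bound for the indicator that a voter prefers `b` to `a`. -/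
lemma sum_alphaIC_mul_exp_le {m : ℕ} {α q l : ℝ} (hq : 1 - α / 2 ≤ q) (hq0 : 0 ≤ q)
    (hq1 : q ≤ 1) (h1 : α ≤ 1) (hl : 0 ≤ l) (R : Ranking m) {a b : Fin m} (hab : a ≠ b) :
    ∑ r, alphaIC α R r * Real.exp (l * if r b < r a then 1 else 0) ≤
      Real.exp (l * q + l ^ 2 / 8) := by
  refine le_trans ?_ (bernoulli_mgf_le hq0 hq1 l)
  have hterm (r : Ranking m) : alphaIC α R r * Real.exp (l * if r b < r a then 1 else 0) =
      alphaIC α R r + (Real.exp l - 1) * if r b < r a then alphaIC α R r else 0 := by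
    split_ifs
    · ring_nf
    · simp
  simp only [hterm, sum_add_distrib, ← mul_sum, ← sum_filter, sum_alphaIC]
  nlinarith [mul_le_mul_of_nonneg_left ((sum_alphaIC_lt_le h1 R hab).trans hq)
    (sub_nonneg.2 (Real.one_le_exp hl))]

/-- Chernoff bound for a product measure with positive weights; it is strict because the event
`c < X` is. -/
lemma profileProb_card_lt {n m : ℕ} {π : Fin n → Ranking m → ℝ} (hπ : ∀ i r, 0 < π i r)
    (p : Ranking m → Prop) [DecidablePred p] {c l K : ℝ} (hl : 0 < l)
    (hK : ∀ i, ∑ r, π i r * Real.exp (l * if p r then 1 else 0) ≤ Real.exp K) :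
    profileProb π (fun P => ((univ.filter fun i => p (P i)).card : ℝ) > c) <
      Real.exp (n * K - l * c) := by
  obtain ⟨Ev, hEv⟩ : ∃ Ev : (Fin n → Ranking m) → Prop,
      Ev = fun P => ((univ.filter fun i => p (P i)).card : ℝ) > c := ⟨_, rfl⟩
  rw [← hEv, profileProb]
  have hc (P) (hP : Ev P) : c < ((univ.filter fun i => p (P i)).card : ℝ) := by
    rwa [hEv] at hP
  set E := univ.filter Ev
  rcases E.eq_empty_or_nonempty with h | h
  · rw [h, sum_empty]
    exact Real.exp_pos _
  have hprod (P : Fin n → Ranking m) : 0 < ∏ i, π i (P i) := prod_pos fun i _ => hπ i _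
  have hcard (P : Fin n → Ranking m) : ((univ.filter fun i => p (P i)).card : ℝ) =
      ∑ i, if p (P i) then (1 : ℝ) else 0 := by simp
  calc ∑ P ∈ E, ∏ i, π i (P i)
      < ∑ P ∈ E, (∏ i, π i (P i)) *
          Real.exp (l * (univ.filter fun i => p (P i)).card - l * c) := by
        refine sum_lt_sum_of_nonempty h fun P hP => lt_mul_of_one_lt_right (hprod P) ?_
        rw [Real.one_lt_exp_iff, sub_pos]
        exact mul_lt_mul_of_pos_left (hc P (mem_filter.1 hP).2) hl
    _ ≤ ∑ P : Fin n → Ranking m, (∏ i, π i (P i)) *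
          Real.exp (l * (univ.filter fun i => p (P i)).card - l * c) :=
        sum_le_sum_of_subset_of_nonneg (subset_univ _) fun P _ _ =>
          mul_nonneg (hprod P).le (Real.exp_pos _).le
    _ = (∏ i, ∑ r, π i r * Real.exp (l * if p r then 1 else 0)) * Real.exp (-(l * c)) := by
        rw [prod_univ_sum, Fintype.piFinset_univ, sum_mul]
        refine sum_congr rfl fun P _ => ?_
        rw [sub_eq_add_neg, Real.exp_add, hcard, mul_sum, Real.exp_sum, prod_mul_distrib, mul_assoc]
    _ ≤ (∏ _i : Fin n, Real.exp K) * Real.exp (-(l * c)) := by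
        refine mul_le_mul_of_nonneg_right (prod_le_prod (fun i _ => ?_) fun i _ => hK i)
          (Real.exp_pos _).le
        exact sum_nonneg fun r _ => mul_nonneg (hπ i r).le (Real.exp_pos _).le
    _ = Real.exp (n * K - l * c) := by
        rw [prod_const, card_univ, Fintype.card_fin, ← Real.exp_nat_mul, ← Real.exp_add,
          sub_eq_add_neg]

/-- with each voter `i` drawing independently from the `α`-IC
distribution `π_{R i}` (`1 − 1/m ≤ α ≤ 1`), for distinct `a b` and
`β = (3/4 − 1/(2m))·n/m`, the probability that more than `n/2 + β` voters prefer
`b` to `a` is less than `exp(−n/(72·m²))`. -/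
theorem alphaIC_prec_tail (m n : ℕ) (hm : 3 ≤ m) (α : ℝ)
    (hα1 : 1 - 1 / (m : ℝ) ≤ α) (hα2 : α ≤ 1)
    (R : Fin n → Ranking m) (a b : Fin m) (hab : a ≠ b) :
    profileProb (fun i => alphaIC α (R i))
        (fun P => (((univ.filter fun i => P i b < P i a).card : ℝ) >
          (n : ℝ) / 2 + (3 / 4 - 1 / (2 * (m : ℝ))) * (n : ℝ) / (m : ℝ)))
      < Real.exp (-(n : ℝ) / (72 * (m : ℝ) ^ 2)) := by
  have hm3 : (3 : ℝ) ≤ m := by exact_mod_cast hm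
  have hm0 : (0 : ℝ) < m := by linarith
  have hinv : 1 / (m : ℝ) ≤ 1 / 3 := one_div_le_one_div_of_le (by norm_num) hm3
  have hinv0 : 0 < 1 / (m : ℝ) := by positivity
  have hα0 : 0 < α := by linarith
  let q : ℝ := 1 / 2 + 1 / m / 2
  let l : ℝ := (m - 2) / m ^ 2
  have hl : 0 < l := div_pos (by linarith) (by positivity)
  refine (profileProb_card_lt (l := l) (K := l * q + l ^ 2 / 8)
    (fun i r => alphaIC_pos hα0 hα2 (R i) r) (fun r => r b < r a) hl fun i =>
      sum_alphaIC_mul_exp_le (by simp only [q]; linarith) (by positivity)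
        (by simp only [q]; linarith) hα2 hl.le (R i) hab).trans_le ?_
  rw [Real.exp_le_exp]
  have hexp : n * (l * q + l ^ 2 / 8) -
      l * (n / 2 + (3 / 4 - 1 / (2 * m)) * n / m) = -(n * (l ^ 2 / 8)) := by
    simp only [l, q]
    field_simp
    ring
  rw [hexp, neg_div, neg_le_neg_iff, div_eq_mul_one_div]
  refine mul_le_mul_of_nonneg_left ?_ (Nat.cast_nonneg n)
  have hl3 : 1 / (3 * (m : ℝ)) ≤ l := by
    simp only [l]
    rw [div_le_div_iff₀ (by positivity) (by positivity)]
    nlinarith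
  calc 1 / (72 * (m : ℝ) ^ 2) = (1 / (3 * (m : ℝ))) ^ 2 / 8 := by
        field_simp
        norm_num
    _ ≤ l ^ 2 / 8 := by gcongr
end

section
/- Let P = (≻_1,…,≻_n) be a profile over A_m and let a ∈ A_m. Suppose that for every alternative b ≠ a, the number of voters i with a ⋖_i b is at least deficit_P(a,b). Then the Dodgson score of a in P equals Σ_{b ≠ a} deficit_P(a,b). -/
open Finset

/-- `deficit P a b = max(0, ⌊n/2⌋ + 1 − #{i : a ≻_i b})`: the number of additional
pairwise votes `a` needs to strictly beat `b` (truncated ℕ-subtraction realizes the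
`max` with `0`). -/
def deficit {n m : ℕ} (P : Fin n → Ranking m) (a b : Fin m) : ℕ :=
  n / 2 + 1 - (univ.filter fun i => P i a < P i b).card

theorem condorcetWinner_iff_sum_deficit_eq_zero {n m : ℕ} (P : Fin n → Ranking m) (a : Fin m) :
    CondorcetWinner P a ↔ ∑ b ∈ univ.erase a, deficit P a b = 0 := by
  simp only [CondorcetWinner, deficit, Finset.sum_eq_zero_iff, mem_erase, mem_univ, and_true]
  refine forall₂_congr fun b _ => ?_
  omega

theorem AdjStep.exists_card_le {n m : ℕ} {P P' : Fin n → Ranking m} (hs : AdjStep P P')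
    (a : Fin m) : ∃ b₀ : Fin m, ∀ b : Fin m,
      (univ.filter fun i => P' i a < P' i b).card ≤
        (univ.filter fun i => P i a < P i b).card + if b = b₀ then 1 else 0 := by
  obtain ⟨i, j, hj, hi, hk⟩ := hs
  refine ⟨(P i).symm ⟨j, Nat.lt_of_succ_lt hj⟩, fun b => ?_⟩
  split_ifs with hb
  · refine (card_le_card (t := insert i (univ.filter fun i => P i a < P i b)) ?_).trans
      (card_insert_le _ _)
    intro k
    by_cases h : k = i <;> simp_all
  · rw [add_zero]
    refine card_le_card fun k => ?_
    simp only [mem_filter, mem_univ, true_and]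
    by_cases h : k = i
    · subst h
      rw [Equiv.eq_symm_apply] at hb
      rw [hi]
      simp only [Equiv.trans_apply, Equiv.swap_apply_def, Fin.ext_iff, Fin.lt_def] at hb ⊢
      split_ifs <;> simp_all <;> omega
    · rw [hk k h]
      exact id

theorem AdjStep.sum_deficit_le {n m : ℕ} {P P' : Fin n → Ranking m} (hs : AdjStep P P')
    (a : Fin m) :
    ∑ b ∈ univ.erase a, deficit P a b ≤ ∑ b ∈ univ.erase a, deficit P' a b + 1 := by
  obtain ⟨b₀, h⟩ := hs.exists_card_le a
  calc ∑ b ∈ univ.erase a, deficit P a b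
      ≤ ∑ b ∈ univ.erase a, (deficit P' a b + if b = b₀ then 1 else 0) := by
        refine sum_le_sum fun b _ => ?_
        have := h b
        unfold deficit
        omega
    _ ≤ ∑ b ∈ univ.erase a, deficit P' a b + 1 := by
        rw [sum_add_distrib, sum_ite_eq']
        split_ifs <;> omega

theorem sum_deficit_le_of_adjStep_chain {n m : ℕ} (a : Fin m) (Q : ℕ → Fin n → Ranking m)
    (k : ℕ) (hQ : ∀ t < k, AdjStep (Q t) (Q (t + 1))) :
    ∑ b ∈ univ.erase a, deficit (Q 0) a b ≤ ∑ b ∈ univ.erase a, deficit (Q k) a b + k := by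
  induction k with
  | zero => exact le_rfl
  | succ k ih =>
    have h₁ := ih fun t ht => hQ t (Nat.lt_succ_of_lt ht)
    have h₂ := (hQ k (Nat.lt_succ_self k)).sum_deficit_le a
    omega

/-- Raising `a` above an alternative `b` ranked immediately above it by voter `i` gains one vote
against `b`, loses no vote, and costs only the adjacency of `b` and `a` for voter `i`. -/
theorem exists_adjStep_of_immediately_above {n m : ℕ} (P : Fin n → Ranking m) {a b : Fin m}
    {i : Fin n} (hi : (P i a : ℕ) = (P i b : ℕ) + 1) :
    ∃ P' : Fin n → Ranking m, AdjStep P P' ∧ ∀ c : Fin m, c ≠ a →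
      (univ.filter fun k => P k a < P k c).card + (if c = b then 1 else 0) ≤
        (univ.filter fun k => P' k a < P' k c).card ∧
      (univ.filter fun k => (P k a : ℕ) = (P k c : ℕ) + 1).card ≤
        (univ.filter fun k => (P' k a : ℕ) = (P' k c : ℕ) + 1).card +
          if c = b then 1 else 0 := by
  have hj : (P i b : ℕ) + 1 < m := hi ▸ (P i a).isLt
  have ha : (⟨(P i b : ℕ) + 1, hj⟩ : Fin m) = P i a := Fin.ext hi.symm
  refine ⟨Function.update P i ((P i).trans (Equiv.swap (P i b) (P i a))),
    ⟨i, P i b, hj, by rw [ha]; simp, fun k hk => by simp [hk]⟩, fun c hc => ?_⟩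
  set P' := Function.update P i ((P i).trans (Equiv.swap (P i b) (P i a))) with hP'
  have hother : ∀ k, k ≠ i → P' k = P k := fun k hk => by simp [hP', hk]
  have ha' : P' i a = P i b := by simp [hP']
  have hb' : P' i b = P i a := by simp [hP']
  by_cases hcb : c = b
  · subst hcb
    simp only [if_true]
    constructor
    · rw [← card_insert_of_notMem (a := i) (by
        simp only [mem_filter, mem_univ, true_and, Fin.lt_def]
        omega)]
      refine card_le_card fun k => ?_
      by_cases hk : k = i
      · subst hk
        simp only [mem_insert, mem_filter, mem_univ, true_and, true_or, ha', hb', Fin.lt_def, hi,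
          Nat.lt_succ_self, imp_self]
      · simp [hk, hother k hk]
    · refine (card_le_card (t := insert i _) fun k => ?_).trans (card_insert_le _ _)
      by_cases hk : k = i
      · simp [hk]
      · simp [hk, hother k hk]
  · have hc' : P' i c = P i c := by
      simp [hP', Equiv.swap_apply_of_ne_of_ne, hc, hcb]
    have hne : (P i c : ℕ) ≠ P i b := fun h => hcb ((P i).injective (Fin.ext h))
    simp only [if_neg hcb, add_zero]
    constructor <;> refine card_le_card fun k => ?_ <;>
      simp only [mem_filter, mem_univ, true_and, Fin.lt_def] <;> by_cases hk : k = i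
    · subst hk
      rw [ha', hc']
      omega
    · rw [hother k hk]
      exact id
    · subst hk
      rw [ha', hc']
      omega
    · rw [hother k hk]
      exact id

theorem exists_adjStep_chain_of_sum_deficit_eq {n m : ℕ} (a : Fin m) (k : ℕ)
    (P : Fin n → Ranking m) (hk : ∑ b ∈ univ.erase a, deficit P a b = k)
    (h : ∀ b : Fin m, b ≠ a →
      deficit P a b ≤ (univ.filter fun i => (P i a : ℕ) = (P i b : ℕ) + 1).card) :
    ∃ Q : ℕ → (Fin n → Ranking m), Q 0 = P ∧
      (∀ t < k, AdjStep (Q t) (Q (t + 1))) ∧ CondorcetWinner (Q k) a := by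
  induction k generalizing P with
  | zero =>
    exact ⟨fun _ => P, rfl, fun t ht => absurd ht t.not_lt_zero,
      (condorcetWinner_iff_sum_deficit_eq_zero P a).2 hk⟩
  | succ k ih =>
    obtain ⟨b, hb, hpos⟩ := exists_ne_zero_of_sum_ne_zero (hk.trans_ne k.succ_ne_zero)
    have hba := ne_of_mem_erase hb
    obtain ⟨i, hi⟩ := card_pos.1 ((Nat.pos_of_ne_zero hpos).trans_le (h b hba))
    obtain ⟨P', hs, hP'⟩ := exists_adjStep_of_immediately_above P (mem_filter.1 hi).2
    have hdef : ∀ c, c ≠ a → deficit P' a c + (if c = b then 1 else 0) ≤ deficit P a c := by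
      intro c hc
      have hcard := (hP' c hc).1
      by_cases hcb : c = b
      · subst hcb
        simp only [if_true] at hcard ⊢
        unfold deficit at hpos ⊢
        omega
      · simp only [if_neg hcb] at hcard ⊢
        unfold deficit
        omega
    have hsum := sum_le_sum fun c (hc : c ∈ univ.erase a) => hdef c (ne_of_mem_erase hc)
    rw [sum_add_distrib, sum_ite_eq', if_pos hb] at hsum
    have hle := hs.sum_deficit_le a
    obtain ⟨Q, hQ₀, hQ, hw⟩ := ih P' (by omega) fun c hc => by
      have h₁ := hdef c hc
      have h₂ := (hP' c hc).2
      have h₃ := h c hc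
      omega
    refine ⟨fun t => if t = 0 then P else Q (t - 1), if_pos rfl, fun t ht => ?_, ?_⟩
    · cases t with
      | zero => simpa [hQ₀] using hs
      | succ t => simpa using hQ t (Nat.lt_of_succ_lt_succ ht)
    · simpa using hw

/-- if for every `b ≠ a` at least `deficit P a b` voters rank `b`
immediately above `a`, then the Dodgson score of `a` equals `Σ_{b ≠ a} deficit P a b`. -/
theorem dodgsonScore_eq_sum_deficit (n m : ℕ) (hm : 3 ≤ m) (hn : 1 ≤ n)
    (P : Fin n → Ranking m) (a : Fin m)
    (h : ∀ b : Fin m, b ≠ a →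
      deficit P a b ≤ (univ.filter fun i => (P i a : ℕ) = (P i b : ℕ) + 1).card) :
    dodgsonScore P a = ∑ b ∈ univ.erase a, deficit P a b := by
  have hmem := exists_adjStep_chain_of_sum_deficit_eq a _ P rfl h
  refine le_antisymm (Nat.sInf_le hmem) (le_csInf ⟨_, hmem⟩ ?_)
  rintro k ⟨Q, rfl, hQ, hw⟩
  have hchain := sum_deficit_le_of_adjStep_chain a Q k hQ
  rwa [(condorcetWinner_iff_sum_deficit_eq_zero _ a).1 hw, zero_add] at hchain
end
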